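/- arXiv:1304.7510 — 5 statements merged into one kernel-verified Lean document; each statement's English description precedes it below -/
import Mathlib

section
/- For all real numbers β < α and every u > 0, the pushforward of the product measure μ_β ⊗ ν_{β,α} under the multiplication map (t,s) ↦ t·s assigns to the interval (u, ∞) the mass ∫_u^∞ w^{-α-1} e^{-w} dw; that is, ((t,s) ↦ t·s)_*(μ_β ⊗ ν_{β,α})((u,∞)) = ∫_u^∞ w^{-α-1} e^{-w} dw. -/
open MeasureTheory Real Set

/-- The Gamma-type measure `μ_β` on `(0,∞)` with density `t ↦ t^(-β-1) e^(-t)`. -/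
noncomputable def gammaTypeMeasure (β : ℝ) : Measure ℝ :=
  (volume.restrict (Set.Ioi (0 : ℝ))).withDensity
    (fun t => ENNReal.ofReal (t ^ (-β - 1) * Real.exp (-t)))

/-- The Beta-type measure `ν_{β,α}` on `(0,1)` with density
`s ↦ (Γ(α-β))⁻¹ (1-s)^(α-β-1) s^(-α-1)`. -/
noncomputable def betaTypeMeasure (β α : ℝ) : Measure ℝ :=
  (volume.restrict (Set.Ioo (0 : ℝ) 1)).withDensity
    (fun s => ENNReal.ofReal ((Real.Gamma (α - β))⁻¹ * (1 - s) ^ (α - β - 1) * s ^ (-α - 1)))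


/-- Scaling for the Lebesgue integral on the line. -/
lemma aux_scale (a : ℝ) (ha : 0 < a) (K : ℝ → ENNReal) (hK : Measurable K) :
    ∫⁻ s, K s = ENNReal.ofReal a⁻¹ * ∫⁻ w, K (a⁻¹ * w) := by
  have h := Real.smul_map_volume_mul_left (inv_pos.2 ha).ne'
  conv_lhs => rw [← h]
  rw [lintegral_smul_measure, lintegral_map hK (by fun_prop), abs_of_pos (inv_pos.2 ha)]
  rfl

/-- The shifted Gamma integral. -/
lemma aux_gamma (c w : ℝ) (hc : 0 < c) :
    ∫⁻ t, (Ioi w).indicator (fun t => ENNReal.ofReal ((t - w) ^ (c - 1) * Real.exp (-t))) t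
      = ENNReal.ofReal (Real.Gamma c * Real.exp (-w)) := by
  rw [← lintegral_add_right_eq_self _ w]
  have h1 : ∀ r : ℝ, (Ioi w).indicator
      (fun t => ENNReal.ofReal ((t - w) ^ (c - 1) * Real.exp (-t))) (r + w)
      = (Ioi (0:ℝ)).indicator (fun r => ENNReal.ofReal ((Real.exp (-r) * r ^ (c - 1)) * Real.exp (-w))) r := by
    intro r
    by_cases hr : 0 < r
    · rw [indicator_of_mem (by simpa using hr), indicator_of_mem (by simpa using hr)]
      congr 1
      rw [neg_add, Real.exp_add, add_sub_cancel_right]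
      ring
    · rw [indicator_of_notMem (by simpa using hr), indicator_of_notMem (by simpa using hr)]
  simp_rw [h1]
  rw [lintegral_indicator measurableSet_Ioi, Real.Gamma_eq_integral hc, ← integral_mul_const,
    ofReal_integral_eq_lintegral_ofReal]
  · exact (Real.GammaIntegral_convergent hc).mul_const _
  · filter_upwards [ae_restrict_mem measurableSet_Ioi] with r hr
    have : (0:ℝ) < r := hr
    simp only [Pi.zero_apply]
    positivity

/-- The pointwise identity of densities. -/
lemma aux_point (β α : ℝ) (t w : ℝ) (hw : 0 < w) (h : w < t) :
    t⁻¹ * ((t ^ (-β - 1) * Real.exp (-t)) *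
      ((Real.Gamma (α - β))⁻¹ * (1 - t⁻¹ * w) ^ (α - β - 1) * (t⁻¹ * w) ^ (-α - 1)))
    = w ^ (-α - 1) * (Real.Gamma (α - β))⁻¹ * ((t - w) ^ (α - β - 1) * Real.exp (-t)) := by
  have ht : 0 < t := hw.trans h
  have e1 : 1 - t⁻¹ * w = t⁻¹ * (t - w) := by field_simp
  rw [e1, Real.mul_rpow (by positivity) (by linarith), Real.mul_rpow (by positivity) hw.le,
    Real.inv_rpow ht.le, Real.inv_rpow ht.le, ← Real.rpow_neg ht.le, ← Real.rpow_neg ht.le]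
  have e2 : t⁻¹ * t ^ (-β - 1) * t ^ (-(α - β - 1)) * t ^ (-(-α - 1)) = 1 := by
    rw [← Real.rpow_neg_one t, ← Real.rpow_add ht, ← Real.rpow_add ht, ← Real.rpow_add ht]
    ring_nf
    simp
  linear_combination (w ^ (-α - 1) * (Real.Gamma (α - β))⁻¹ *
    ((t - w) ^ (α - β - 1) * Real.exp (-t))) * e2

theorem pushforward_mul_Ioi (β α : ℝ) (hβα : β < α) (u : ℝ) (hu : 0 < u) :
    Measure.map (fun p : ℝ × ℝ => p.1 * p.2)
        ((gammaTypeMeasure β).prod (betaTypeMeasure β α)) (Set.Ioi u)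
      = ∫⁻ w in Set.Ioi u, ENNReal.ofReal (w ^ (-α - 1) * Real.exp (-w)) := by
  have hc : 0 < α - β := sub_pos.2 hβα
  have hG := Real.Gamma_pos_of_pos hc
  set f : ℝ → ENNReal := (Ioi (0:ℝ)).indicator
    (fun t => ENNReal.ofReal (t ^ (-β - 1) * Real.exp (-t))) with hf
  set g : ℝ → ENNReal := (Ioo (0:ℝ) 1).indicator
    (fun s => ENNReal.ofReal ((Real.Gamma (α - β))⁻¹ * (1 - s) ^ (α - β - 1) * s ^ (-α - 1))) with hg
  have mf : Measurable f := Measurable.indicator (by fun_prop) measurableSet_Ioi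
  have mg : Measurable g := Measurable.indicator (by fun_prop) measurableSet_Ioo
  have e1 : gammaTypeMeasure β = volume.withDensity f := by
    rw [gammaTypeMeasure, hf, withDensity_indicator measurableSet_Ioi]
  have e2 : betaTypeMeasure β α = volume.withDensity g := by
    rw [betaTypeMeasure, hg, withDensity_indicator measurableSet_Ioo]
  have mm : Measurable (fun p : ℝ × ℝ => p.1 * p.2) := by fun_prop
  set k : ℝ → ENNReal := (Ioi u).indicator (fun _ => 1) with hk
  have mk : Measurable k := measurable_const.indicator measurableSet_Ioi
  rw [Measure.map_apply mm measurableSet_Ioi, e1, e2, prod_withDensity mf mg,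
    withDensity_apply _ (mm measurableSet_Ioi), ← lintegral_indicator (mm measurableSet_Ioi)]
  have e3 : ∀ p : ℝ × ℝ, ((fun p : ℝ × ℝ => p.1 * p.2) ⁻¹' Ioi u).indicator
      (fun p => f p.1 * g p.2) p = f p.1 * g p.2 * k (p.1 * p.2) := by
    intro p
    by_cases hp : u < p.1 * p.2
    · rw [indicator_of_mem (by simpa using hp), hk, indicator_of_mem (by simpa using hp), mul_one]
    · rw [indicator_of_notMem (by simpa using hp), hk, indicator_of_notMem (by simpa using hp),
        mul_zero]
  simp_rw [e3]
  rw [lintegral_prod _ (by fun_prop)]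
  simp only
  set H : ℝ → ℝ → ENNReal := fun t w =>
    k w * ENNReal.ofReal (w ^ (-α - 1) * (Real.Gamma (α - β))⁻¹) *
      (Ioi w).indicator (fun t => ENNReal.ofReal ((t - w) ^ (α - β - 1) * Real.exp (-t))) t with hH
  have e4 : ∀ t : ℝ, ∫⁻ s, f t * g s * k (t * s) = ∫⁻ w, H t w := by
    intro t
    by_cases ht : 0 < t
    · rw [aux_scale t ht _ (by fun_prop), ← lintegral_const_mul _ (by fun_prop)]
      refine lintegral_congr fun w => ?_
      rw [mul_inv_cancel_left₀ ht.ne']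
      simp only [hH]
      by_cases hw : u < w
      · have hw0 : 0 < w := hu.trans hw
        by_cases h : w < t
        · have hm : t⁻¹ * w ∈ Ioo (0:ℝ) 1 :=
            ⟨by positivity, by rw [inv_mul_lt_iff₀ ht]; linarith⟩
          rw [hf, hg, indicator_of_mem (by simpa using ht), indicator_of_mem hm,
            indicator_of_mem (by simpa using h), mul_comm _ (k w), mul_left_comm, mul_assoc (k w)]
          congr 1
          rw [← ENNReal.ofReal_mul (by positivity), ← ENNReal.ofReal_mul (by positivity),
            ← ENNReal.ofReal_mul (by positivity), aux_point β α t w hw0 h]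
        · have hm : t⁻¹ * w ∉ Ioo (0:ℝ) 1 := by
            rintro ⟨_, h2⟩
            rw [inv_mul_lt_iff₀ ht] at h2
            linarith
          rw [hg, indicator_of_notMem hm, indicator_of_notMem (by simpa using h)]
          simp
      · rw [hk, indicator_of_notMem (by simpa using hw)]
        simp
    · have h0 : f t = 0 := by rw [hf, indicator_of_notMem (by simpa using ht)]
      have h1 : ∀ w, H t w = 0 := by
        intro w
        simp only [hH]
        by_cases hw : u < w
        · rw [indicator_of_notMem (s := Ioi w) (by simp only [mem_Ioi]; linarith), mul_zero]
        · rw [hk, indicator_of_notMem (by simpa using hw)]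
          simp
      simp [h0, h1]
  simp_rw [e4]
  have mH : Measurable (Function.uncurry H) := by
    have : Measurable (fun p : ℝ × ℝ => {q : ℝ × ℝ | q.2 < q.1}.indicator
        (fun q => ENNReal.ofReal ((q.1 - q.2) ^ (α - β - 1) * Real.exp (-q.1))) p) :=
      Measurable.indicator (by fun_prop) (measurableSet_lt measurable_snd measurable_fst)
    have h2 : Measurable (fun p : ℝ × ℝ => k p.2 *
      ENNReal.ofReal (p.2 ^ (-α - 1) * (Real.Gamma (α - β))⁻¹)) := by fun_prop
    exact h2.mul this
  rw [lintegral_lintegral_swap mH.aemeasurable, ← lintegral_indicator measurableSet_Ioi]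
  refine lintegral_congr fun w => ?_
  simp only [hH]
  rw [lintegral_const_mul _ (Measurable.indicator (by fun_prop) measurableSet_Ioi),
    aux_gamma _ _ hc]
  by_cases hw : u < w
  · have hw0 : 0 < w := hu.trans hw
    rw [hk, indicator_of_mem (by simpa using hw), indicator_of_mem (by simpa using hw), one_mul,
      ← ENNReal.ofReal_mul (by positivity)]
    congr 1
    field_simp
  · rw [hk, indicator_of_notMem (by simpa using hw), indicator_of_notMem (by simpa using hw)]
    simp
end

section
/- For all real numbers β < α, the pushforward of the product measure μ_β ⊗ ν_{β,α} under the multiplication map (t,s) ↦ t·s equals μ_α; equivalently, for every measurable function Φ : (0,∞) → [0,∞], ∫_{(0,∞)} ∫_{(0,1)} Φ(t·s) dν_{β,α}(s) dμ_β(t) = ∫_0^∞ Φ(w) w^{-α-1} e^{-w} dw. -/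
open MeasureTheory Real Set

/-- Joint density after the change of variables `w = t * s`. -/
noncomputable def auxF (β α : ℝ) (Φ : ℝ → ENNReal) (t w : ℝ) : ENNReal :=
  (Set.Ioi (0 : ℝ)).indicator (fun w => Φ w *
    (Set.Ioi (0 : ℝ)).indicator (fun u => ENNReal.ofReal ((Real.Gamma (α - β))⁻¹ *
      u ^ (α - β - 1) * w ^ (-α - 1) * Real.exp (-(u + w)))) (t - w)) w

lemma auxF_measurable (β α : ℝ) (Φ : ℝ → ENNReal) (hΦ : Measurable Φ) :
    Measurable (fun p : ℝ × ℝ => auxF β α Φ p.1 p.2) := by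
  have h : (fun p : ℝ × ℝ => auxF β α Φ p.1 p.2) =
      ({p : ℝ × ℝ | 0 < p.2}).indicator (fun p => Φ p.2 *
        ({p : ℝ × ℝ | 0 < p.1 - p.2}).indicator (fun p => ENNReal.ofReal ((Real.Gamma (α - β))⁻¹ *
      (p.1 - p.2) ^ (α - β - 1) * p.2 ^ (-α - 1) * Real.exp (-(p.1 - p.2 + p.2)))) p) := by
    ext p
    simp only [auxF, Set.indicator, Set.mem_Ioi, Set.mem_ofPred_eq]
  rw [h]
  refine Measurable.indicator ?_ (measurableSet_lt measurable_const measurable_snd)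
  refine (hΦ.comp measurable_snd).mul ?_
  refine Measurable.indicator ?_
    (measurableSet_lt measurable_const (measurable_fst.sub measurable_snd))
  fun_prop

lemma scale_lintegral (f : ℝ → ENNReal) (hf : Measurable f) (t : ℝ) (ht : 0 < t) :
    ∫⁻ w, f w = ENNReal.ofReal t * ∫⁻ s, f (t * s) := by
  have h := Real.smul_map_volume_mul_left ht.ne'
  conv_lhs => rw [← h]
  rw [lintegral_smul_measure, lintegral_map hf (measurable_const_mul t), abs_of_pos ht]
  rfl

lemma gamma_lintegral (c : ℝ) (hc : 0 < c) :
    ∫⁻ u in Set.Ioi (0 : ℝ), ENNReal.ofReal (Real.exp (-u) * u ^ (c - 1)) =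
      ENNReal.ofReal (Real.Gamma c) := by
  rw [Real.Gamma_eq_integral hc, ofReal_integral_eq_lintegral_ofReal]
  · exact Real.GammaIntegral_convergent hc
  · filter_upwards [ae_restrict_mem measurableSet_Ioi] with u hu
    have : 0 < u := hu
    simp only [Pi.zero_apply]
    positivity

lemma inner_t (β α : ℝ) (hβα : β < α) (Φ : ℝ → ENNReal) (w : ℝ) :
    ∫⁻ t, auxF β α Φ t w = (Set.Ioi (0 : ℝ)).indicator
      (fun w => Φ w * ENNReal.ofReal (w ^ (-α - 1) * Real.exp (-w))) w := by
  by_cases hw : w ∈ Set.Ioi (0 : ℝ)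
  · have hw' : 0 < w := hw
    have hG : 0 < Real.Gamma (α - β) := Real.Gamma_pos_of_pos (by linarith)
    have hm : Measurable ((Set.Ioi (0 : ℝ)).indicator
      (fun u => ENNReal.ofReal ((Real.Gamma (α - β))⁻¹ *
      u ^ (α - β - 1) * w ^ (-α - 1) * Real.exp (-(u + w))))) :=
      Measurable.indicator (by fun_prop) measurableSet_Ioi
    simp only [auxF, Set.indicator_of_mem hw]
    have hm2 : Measurable (fun t : ℝ => (Set.Ioi (0 : ℝ)).indicator
      (fun u => ENNReal.ofReal ((Real.Gamma (α - β))⁻¹ *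
      u ^ (α - β - 1) * w ^ (-α - 1) * Real.exp (-(u + w)))) (t - w)) :=
      hm.comp (measurable_id.sub_const w)
    rw [lintegral_const_mul _ hm2]
    congr 1
    rw [lintegral_sub_right_eq_self (μ := volume) ((Set.Ioi (0 : ℝ)).indicator
      (fun u => ENNReal.ofReal ((Real.Gamma (α - β))⁻¹ *
      u ^ (α - β - 1) * w ^ (-α - 1) * Real.exp (-(u + w))))) w]
    rw [lintegral_indicator measurableSet_Ioi]
    have h : ∀ u : ℝ, ENNReal.ofReal ((Real.Gamma (α - β))⁻¹ *
      u ^ (α - β - 1) * w ^ (-α - 1) * Real.exp (-(u + w))) =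
      ENNReal.ofReal ((Real.Gamma (α - β))⁻¹ * (w ^ (-α - 1) * Real.exp (-w))) *
        ENNReal.ofReal (Real.exp (-u) * u ^ (α - β - 1)) := by
      intro u
      rw [← ENNReal.ofReal_mul (by positivity), neg_add, Real.exp_add]
      congr 1
      ring
    simp only [h]
    rw [lintegral_const_mul _ (by fun_prop), gamma_lintegral _ (by linarith),
      ← ENNReal.ofReal_mul (by positivity)]
    congr 1
    field_simp
  · simp [auxF, Set.indicator_of_notMem hw]

lemma inner_s (β α : ℝ) (hβα : β < α) (Φ : ℝ → ENNReal) (hΦ : Measurable Φ) (t : ℝ) :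
    (Set.Ioi (0 : ℝ)).indicator (fun t => ENNReal.ofReal (t ^ (-β - 1) * Real.exp (-t)) *
      ∫⁻ s, Φ (t * s) ∂(betaTypeMeasure β α)) t = ∫⁻ w, auxF β α Φ t w := by
  have hG : 0 < Real.Gamma (α - β) := Real.Gamma_pos_of_pos (by linarith)
  by_cases ht : t ∈ Set.Ioi (0 : ℝ)
  · have ht' : 0 < t := ht
    rw [Set.indicator_of_mem ht, scale_lintegral (fun w => auxF β α Φ t w)
      ((auxF_measurable β α Φ hΦ).comp (measurable_const.prodMk measurable_id)) t ht']
    have hΦt : Measurable (fun s => Φ (t * s)) := hΦ.comp (measurable_const_mul t)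
    rw [betaTypeMeasure, lintegral_withDensity_eq_lintegral_mul _ (by fun_prop) hΦt,
      ← lintegral_indicator measurableSet_Ioo, ← lintegral_const_mul' _ _ ENNReal.ofReal_ne_top,
      ← lintegral_const_mul' _ _ ENNReal.ofReal_ne_top]
    congr 1
    ext s
    simp only [auxF]
    by_cases hs0 : 0 < s
    swap
    · have h1 : s ∉ Set.Ioo (0 : ℝ) 1 := fun h => hs0 h.1
      have h2 : t * s ∉ Set.Ioi (0 : ℝ) := fun h => hs0 (pos_of_mul_pos_right h ht'.le)
      rw [Set.indicator_of_notMem h1, Set.indicator_of_notMem h2, mul_zero, mul_zero]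
    have h2 : t * s ∈ Set.Ioi (0 : ℝ) := mul_pos ht' hs0
    rw [Set.indicator_of_mem h2]
    by_cases hs1 : s < 1
    swap
    · have h1 : s ∉ Set.Ioo (0 : ℝ) 1 := fun h => hs1 h.2
      have h3 : t - t * s ∉ Set.Ioi (0 : ℝ) := by
        simp only [Set.mem_Ioi]
        nlinarith
      rw [Set.indicator_of_notMem h1, Set.indicator_of_notMem h3]
      simp
    have h1 : s ∈ Set.Ioo (0 : ℝ) 1 := ⟨hs0, hs1⟩
    have hs1' : 0 < 1 - s := by linarith
    have e : t - t * s = t * (1 - s) := by ring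
    have h3 : t * (1 - s) ∈ Set.Ioi (0 : ℝ) := mul_pos ht' hs1'
    rw [Set.indicator_of_mem h1, e, Set.indicator_of_mem h3, Pi.mul_apply, ← mul_assoc,
      ← ENNReal.ofReal_mul (by positivity), mul_left_comm (ENNReal.ofReal t),
      ← ENNReal.ofReal_mul ht'.le, mul_comm]
    congr 2
    rw [Real.mul_rpow ht'.le hs1'.le, Real.mul_rpow ht'.le hs0.le]
    have e2 : t * (1 - s) + t * s = t := by ring
    have e3 : t ^ (-β - 1) = t * (t ^ (α - β - 1) * t ^ (-α - 1)) := by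
      rw [← Real.rpow_add ht']
      nth_rewrite 2 [← Real.rpow_one t]
      rw [← Real.rpow_add ht']
      congr 1
      ring
    rw [e2, e3]
    ring
  · rw [Set.indicator_of_notMem ht]
    have : ∀ w, auxF β α Φ t w = 0 := by
      intro w
      unfold auxF
      by_cases hw : w ∈ Set.Ioi (0 : ℝ)
      · have h3 : t - w ∉ Set.Ioi (0 : ℝ) := by
          simp only [Set.mem_Ioi] at *
          linarith
        rw [Set.indicator_of_mem hw, Set.indicator_of_notMem h3, mul_zero]
      · rw [Set.indicator_of_notMem hw]
    simp [this]

instance betaType_sFinite (β α : ℝ) : SFinite (betaTypeMeasure β α) := by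
  unfold betaTypeMeasure
  infer_instance

lemma main_lintegral (β α : ℝ) (hβα : β < α) (Φ : ℝ → ENNReal) (hΦ : Measurable Φ) :
    ∫⁻ t, (∫⁻ s, Φ (t * s) ∂(betaTypeMeasure β α)) ∂(gammaTypeMeasure β)
        = ∫⁻ w in Set.Ioi (0 : ℝ), Φ w * ENNReal.ofReal (w ^ (-α - 1) * Real.exp (-w)) := by
  have hm : Measurable (fun t => ∫⁻ s, Φ (t * s) ∂(betaTypeMeasure β α)) :=
    Measurable.lintegral_prod_right' (f := fun p : ℝ × ℝ => Φ (p.1 * p.2))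
      (hΦ.comp (measurable_fst.mul measurable_snd))
  rw [gammaTypeMeasure, lintegral_withDensity_eq_lintegral_mul _ (by fun_prop) hm,
    ← lintegral_indicator measurableSet_Ioi, ← lintegral_indicator measurableSet_Ioi]
  simp only [← inner_t β α hβα Φ]
  rw [lintegral_lintegral_swap]
  · congr 1
    ext t
    rw [← inner_s β α hβα Φ hΦ t]
    rfl
  · exact ((auxF_measurable β α Φ hΦ).comp measurable_swap).aemeasurable

theorem pushforward_mul_eq_gammaType (β α : ℝ) (hβα : β < α) :
    Measure.map (fun p : ℝ × ℝ => p.1 * p.2)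
        ((gammaTypeMeasure β).prod (betaTypeMeasure β α)) = gammaTypeMeasure α ∧
    ∀ Φ : ℝ → ENNReal, Measurable Φ →
      ∫⁻ t, (∫⁻ s, Φ (t * s) ∂(betaTypeMeasure β α)) ∂(gammaTypeMeasure β)
        = ∫⁻ w in Set.Ioi (0 : ℝ), Φ w * ENNReal.ofReal (w ^ (-α - 1) * Real.exp (-w)) := by
  refine ⟨?_, main_lintegral β α hβα⟩
  refine Measure.ext_of_lintegral _ fun f hf => ?_
  have hmul : Measurable (fun p : ℝ × ℝ => p.1 * p.2) := measurable_fst.mul measurable_snd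
  rw [lintegral_map hf hmul, lintegral_prod (fun p : ℝ × ℝ => f (p.1 * p.2)) (hf.comp hmul).aemeasurable,
    main_lintegral β α hβα f hf, gammaTypeMeasure,
    lintegral_withDensity_eq_lintegral_mul _ (by fun_prop) hf]
  simp only [Pi.mul_apply, mul_comm]
end

section
/- For all real numbers γ < β < α and every measurable function Φ : (0,1) → [0,∞], one has ∫_0^1 ( ∫_0^1 Φ(s·t) (1-t)^{α-β-1} t^{-α-1} dt ) (1-s)^{β-γ-1} s^{-β-1} ds = B(α-β, β-γ) · ∫_0^1 Φ(w) (1-w)^{α-γ-1} w^{-α-1} dw, where B(a,b) = ∫_0^1 (1-u)^{a-1} u^{b-1} du is the Beta function. -/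
open MeasureTheory Real Set

lemma aux_integrable (a b : ℝ) (ha : 0 < a) (hb : 0 < b) :
    IntegrableOn (fun u : ℝ => (1 - u) ^ (a - 1) * u ^ (b - 1)) (Ioo 0 1) := by
  have h := Complex.betaIntegral_convergent (u := (b : ℂ)) (v := (a : ℂ)) (by simpa) (by simpa)
  rw [intervalIntegrable_iff_integrableOn_Ioo_of_le (by simp)] at h
  have h2 := h.re
  refine IntegrableOn.congr_fun h2 ?_ measurableSet_Ioo
  intro x hx
  have h1 : ((x : ℂ) ^ ((b : ℂ) - 1) * (1 - (x : ℂ)) ^ ((a : ℂ) - 1))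
      = (((1 - x) ^ (a - 1) * x ^ (b - 1) : ℝ) : ℂ) := by
    rw [Complex.ofReal_mul, Complex.ofReal_cpow hx.1.le, Complex.ofReal_cpow (by linarith [hx.2])]
    push_cast
    ring
  simp only [h1]
  simp

lemma aux_inner (α β γ s : ℝ) (hs : s ∈ Ioo (0 : ℝ) 1) (Φ : ℝ → ENNReal) (hΦ : Measurable Φ) :
    (∫⁻ t in Ioo (0 : ℝ) 1, Φ (s * t) * ENNReal.ofReal ((1 - t) ^ (α - β - 1) * t ^ (-α - 1)))
          * ENNReal.ofReal ((1 - s) ^ (β - γ - 1) * s ^ (-β - 1))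
    = ∫⁻ w in Ioo (0 : ℝ) s, Φ w * ENNReal.ofReal (w ^ (-α - 1)) *
        ENNReal.ofReal ((s - w) ^ (α - β - 1) * (1 - s) ^ (β - γ - 1)) := by
  obtain ⟨h0, h1⟩ := hs
  have him : (s * ·) '' Ioo (0 : ℝ) 1 = Ioo 0 s := by
    rw [image_mul_left_Ioo h0]; simp
  rw [← him, lintegral_image_eq_lintegral_abs_deriv_mul (f' := fun _ => s) measurableSet_Ioo
    (fun x _ => by simpa using ((hasDerivAt_id x).const_mul s).hasDerivWithinAt)
    (fun x _ y _ h => mul_left_cancel₀ h0.ne' h)]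
  rw [← lintegral_mul_const _ (by fun_prop)]
  refine setLIntegral_congr_fun measurableSet_Ioo fun t ht => ?_
  obtain ⟨t0, t1⟩ := ht
  have e1 : s - s * t = s * (1 - t) := by ring
  have p1 : 0 < 1 - t := by linarith
  have p2 : 0 < 1 - s := by linarith
  simp only [e1]
  rw [abs_of_pos h0, mul_assoc, mul_assoc, mul_left_comm (ENNReal.ofReal s), ← ENNReal.ofReal_mul (by positivity),
    ← ENNReal.ofReal_mul (by positivity), ← ENNReal.ofReal_mul (by positivity)]
  congr 2
  rw [mul_rpow h0.le t0.le, mul_rpow h0.le p1.le]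
  have : s ^ (-β - 1) = s * s ^ (-α - 1) * s ^ (α - β - 1) := by
    nth_rewrite 2 [← rpow_one s]
    rw [← rpow_add h0, ← rpow_add h0]
    congr 1; ring
  rw [this]; ring

lemma aux_outer (α β γ w : ℝ) (hγβ : γ < β) (hβα : β < α) (hw : w ∈ Ioo (0 : ℝ) 1) :
    ∫⁻ s in Ioo w 1, ENNReal.ofReal ((s - w) ^ (α - β - 1) * (1 - s) ^ (β - γ - 1))
    = ENNReal.ofReal (∫ u in Set.Ioo (0 : ℝ) 1, (1 - u) ^ (α - β - 1) * u ^ (β - γ - 1))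
      * ENNReal.ofReal ((1 - w) ^ (α - γ - 1)) := by
  obtain ⟨h0, h1⟩ := hw
  have p : 0 < 1 - w := by linarith
  have him : (fun u => 1 - (1 - w) * u) '' Ioo (0 : ℝ) 1 = Ioo w 1 := by
    have := Set.image_image (fun x : ℝ => 1 - x) (fun u => (1 - w) * u) (Ioo 0 1)
    rw [← this, image_mul_left_Ioo p, Set.image_const_sub_Ioo]; simp
  rw [← him, lintegral_image_eq_lintegral_abs_deriv_mul (f' := fun _ => -(1 - w)) measurableSet_Ioo
    (fun x _ => by
      simpa using (((hasDerivAt_id x).const_mul (1 - w)).const_sub 1).hasDerivWithinAt)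
    (fun x _ y _ h => mul_left_cancel₀ p.ne' (by simpa using h))]
  rw [ofReal_integral_eq_lintegral_ofReal
    (aux_integrable (α - β) (β - γ) (by linarith) (by linarith)),
    ← lintegral_mul_const _ (by fun_prop)]
  · refine setLIntegral_congr_fun measurableSet_Ioo fun u hu => ?_
    obtain ⟨u0, u1⟩ := hu
    have q : 0 < 1 - u := by linarith
    have e1 : 1 - (1 - w) * u - w = (1 - w) * (1 - u) := by ring
    have e2 : 1 - (1 - (1 - w) * u) = (1 - w) * u := by ring
    simp only [e1, e2]
    rw [abs_neg, abs_of_pos p, ← ENNReal.ofReal_mul (by positivity),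
      ← ENNReal.ofReal_mul (by positivity)]
    congr 1
    rw [mul_rpow p.le q.le, mul_rpow p.le u0.le]
    have : (1 - w) ^ (α - γ - 1) = (1 - w) * (1 - w) ^ (α - β - 1) * (1 - w) ^ (β - γ - 1) := by
      nth_rewrite 2 [← rpow_one (1 - w)]
      rw [← rpow_add p, ← rpow_add p]
      congr 1; ring
    rw [this]; ring
  · refine ae_restrict_of_forall_mem measurableSet_Ioo fun u hu => ?_
    have q : 0 < 1 - u := by linarith [hu.2]
    have := hu.1
    simp only [Pi.zero_apply]
    positivity

theorem beta_type_factorization_lintegral (α β γ : ℝ) (hγβ : γ < β) (hβα : β < α)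
    (Φ : ℝ → ENNReal) (hΦ : Measurable Φ) :
    ∫⁻ s in Set.Ioo (0 : ℝ) 1,
        (∫⁻ t in Set.Ioo (0 : ℝ) 1,
            Φ (s * t) * ENNReal.ofReal ((1 - t) ^ (α - β - 1) * t ^ (-α - 1)))
          * ENNReal.ofReal ((1 - s) ^ (β - γ - 1) * s ^ (-β - 1))
      = ENNReal.ofReal (∫ u in Set.Ioo (0 : ℝ) 1, (1 - u) ^ (α - β - 1) * u ^ (β - γ - 1))
          * ∫⁻ w in Set.Ioo (0 : ℝ) 1,
              Φ w * ENNReal.ofReal ((1 - w) ^ (α - γ - 1) * w ^ (-α - 1)) := by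
  set G : ℝ → ℝ → ENNReal := fun s w => Φ w * ENNReal.ofReal (w ^ (-α - 1)) *
        ENNReal.ofReal ((s - w) ^ (α - β - 1) * (1 - s) ^ (β - γ - 1)) with hG
  have hGm : Measurable (Function.uncurry G) := by
    simp only [hG, Function.uncurry_def]
    fun_prop
  set K : ℝ → ℝ → ENNReal := fun s w => {p : ℝ × ℝ | p.2 < p.1}.indicator (Function.uncurry G) (s, w)
    with hK
  have hKm : Measurable (Function.uncurry K) :=
    hGm.indicator (measurableSet_lt measurable_snd measurable_fst)
  have s1 : ∀ s ∈ Ioo (0 : ℝ) 1, (∫⁻ t in Set.Ioo (0 : ℝ) 1,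
            Φ (s * t) * ENNReal.ofReal ((1 - t) ^ (α - β - 1) * t ^ (-α - 1)))
          * ENNReal.ofReal ((1 - s) ^ (β - γ - 1) * s ^ (-β - 1))
        = ∫⁻ w in Ioo (0 : ℝ) 1, K s w := by
    intro s hs
    rw [aux_inner α β γ s hs Φ hΦ]
    have : K s = (Iio s).indicator (G s) := by
      ext w; simp [hK, indicator, Function.uncurry]
    rw [this, setLIntegral_indicator measurableSet_Iio]
    have : Iio s ∩ Ioo 0 1 = Ioo 0 s := by
      ext w; simp only [mem_inter_iff, mem_Iio, mem_Ioo]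
      constructor
      · rintro ⟨a, b, c⟩; exact ⟨b, a⟩
      · rintro ⟨a, b⟩; exact ⟨b, a, b.trans hs.2⟩
    rw [this]
  rw [setLIntegral_congr_fun measurableSet_Ioo s1, lintegral_lintegral_swap hKm.aemeasurable,
    ← lintegral_const_mul _ (by fun_prop)]
  refine setLIntegral_congr_fun measurableSet_Ioo fun w hw => ?_
  have e : (fun s => K s w) = (Ioi w).indicator (fun s => G s w) := by
    ext s; simp [hK, indicator, Function.uncurry]
  have e2 : Ioi w ∩ Ioo 0 1 = Ioo w 1 := by
    ext s; simp only [mem_inter_iff, mem_Ioi, mem_Ioo]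
    constructor
    · rintro ⟨a, b, c⟩; exact ⟨a, c⟩
    · rintro ⟨a, b⟩; exact ⟨a, hw.1.trans a, b⟩
  simp only [e]
  rw [setLIntegral_indicator measurableSet_Ioi, e2, lintegral_const_mul _ (by fun_prop),
    aux_outer α β γ w hγβ hβα hw, ENNReal.ofReal_mul (rpow_nonneg (by linarith [hw.2]) _)]
  ring
end

section
/- For all real numbers γ < β < α, the pushforward of the product measure ν_{β,α} ⊗ ν_{γ,β} under the multiplication map (t,s) ↦ t·s equals ν_{γ,α}; in particular this pushforward is symmetric in the two factors, so ν_{β,α} ⊗ ν_{γ,β} and ν_{γ,β} ⊗ ν_{β,α} have the same image under multiplication. -/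
open MeasureTheory Real Set

/-- The density of `betaTypeMeasure`. -/
noncomputable def betaDens (β α s : ℝ) : ENNReal :=
  ENNReal.ofReal ((Real.Gamma (α - β))⁻¹ * (1 - s) ^ (α - β - 1) * s ^ (-α - 1))

lemma measurable_betaDens (β α : ℝ) : Measurable (betaDens β α) := by
  unfold betaDens
  fun_prop

lemma lintegral_betaTypeMeasure (β α : ℝ) {φ : ℝ → ENNReal} (hφ : Measurable φ) :
    ∫⁻ s, φ s ∂(betaTypeMeasure β α) = ∫⁻ s in Ioo (0 : ℝ) 1, betaDens β α s * φ s :=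
  lintegral_withDensity_eq_lintegral_mul _ (measurable_betaDens β α) hφ

instance sfinite_betaTypeMeasure (β α : ℝ) : SFinite (betaTypeMeasure β α) := by
  unfold betaTypeMeasure
  infer_instance

lemma rpow_identity (α β γ P u w v D : ℝ) (hP : 0 < P) (hu : 0 < u) (hw : 0 < w) (hv : 0 < v)
    (hD : 0 < D) :
    u * P / D ^ 2 * ((P * w / D) ^ (α - β - 1) * (u / D) ^ (-α - 1)) *
      (D / u * ((P * v) ^ (β - γ - 1) * D ^ (-β - 1))) =
    P ^ (α - γ - 1) * u ^ (-α - 1) * (w ^ (α - β - 1) * v ^ (β - γ - 1)) := by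
  obtain ⟨p, rfl⟩ : ∃ p, P = exp p := ⟨log P, (exp_log hP).symm⟩
  obtain ⟨x, rfl⟩ : ∃ p, u = exp p := ⟨log u, (exp_log hu).symm⟩
  obtain ⟨y, rfl⟩ : ∃ p, w = exp p := ⟨log w, (exp_log hw).symm⟩
  obtain ⟨z, rfl⟩ : ∃ p, v = exp p := ⟨log v, (exp_log hv).symm⟩
  obtain ⟨d, rfl⟩ : ∃ p, D = exp p := ⟨log D, (exp_log hD).symm⟩
  rw [pow_two]
  simp only [← exp_add, ← exp_sub, ← exp_mul]
  congr 1
  ring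

lemma image_mobius (u : ℝ) (hu : 0 < u) (hu1 : u < 1) :
    (fun w : ℝ => u / (u + (1 - u) * w)) '' Ioo 0 1 = Ioo u 1 := by
  have hP : 0 < 1 - u := by linarith
  ext t
  constructor
  · rintro ⟨w, ⟨h0, h1⟩, rfl⟩
    have hD : 0 < u + (1 - u) * w := by positivity
    have := mul_pos hP h0
    constructor
    · rw [lt_div_iff₀ hD]; nlinarith [mul_pos hP (sub_pos.2 h1), mul_pos hu (mul_pos hP (sub_pos.2 h1))]
    · rw [div_lt_one hD]; linarith
  · rintro ⟨h0, h1⟩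
    have ht : 0 < t := hu.trans h0
    refine ⟨(u / t - u) / (1 - u), ⟨?_, ?_⟩, ?_⟩
    · apply div_pos _ hP
      rw [sub_pos, lt_div_iff₀ ht]; nlinarith
    · rw [div_lt_one hP]
      have : u / t < 1 := (div_lt_one ht).2 h0
      linarith
    · have : u + (1 - u) * ((u / t - u) / (1 - u)) = u / t := by
        field_simp
        ring
      simp only [this]
      field_simp

lemma key_integral (α β γ : ℝ) (hγβ : γ < β) (hβα : β < α) (u : ℝ) (hu : 0 < u) (hu1 : u < 1) :
    ∫⁻ t in Ioo u 1, betaDens β α t * (ENNReal.ofReal t⁻¹ * betaDens γ β (t⁻¹ * u)) =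
      betaDens γ α u := by
  have hP : 0 < 1 - u := by linarith
  have hDpos : ∀ w ∈ Ioo (0 : ℝ) 1, 0 < u + (1 - u) * w := by
    rintro w ⟨h0, h1⟩
    positivity
  rw [← image_mobius u hu hu1, lintegral_image_eq_lintegral_abs_deriv_mul
    (f' := fun w => -(u * (1 - u) / (u + (1 - u) * w) ^ 2)) measurableSet_Ioo]
  · have h1 := ProbabilityTheory.lintegral_betaPDF_eq_one (sub_pos.2 hβα) (sub_pos.2 hγβ)
    rw [ProbabilityTheory.lintegral_betaPDF] at h1
    rw [← mul_one (betaDens γ α u), ← h1, ← lintegral_const_mul _ (by fun_prop)]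
    refine setLIntegral_congr_fun measurableSet_Ioo fun w hw => ?_
    have hD := hDpos w hw
    have hv : 0 < 1 - w := by linarith [hw.2]
    have hw0 := hw.1
    have e := rpow_identity α β γ (1 - u) u w (1 - w) _ hP hu hw0 hv hD
    have e1 : 1 - u / (u + (1 - u) * w) = (1 - u) * w / (u + (1 - u) * w) := by
      field_simp
      ring
    have e2 : (u + (1 - u) * w) / u * u = u + (1 - u) * w := by
      field_simp
    have e3 : 1 - (u + (1 - u) * w) = (1 - u) * (1 - w) := by ring
    have ga := Real.Gamma_pos_of_pos (sub_pos.2 hβα)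
    have gb := Real.Gamma_pos_of_pos (sub_pos.2 hγβ)
    have gc := Real.Gamma_pos_of_pos (sub_pos.2 (hγβ.trans hβα))
    have hs : α - β + (β - γ) = α - γ := by ring
    simp only [betaDens, e2, e1, e3, inv_div, abs_neg, ProbabilityTheory.beta, hs]
    rw [abs_of_pos (by positivity)]
    generalize u + (1 - u) * w = D at *
    rw [← ENNReal.ofReal_mul (by positivity), ← ENNReal.ofReal_mul (by positivity),
      ← ENNReal.ofReal_mul (by positivity), ← ENNReal.ofReal_mul (by positivity)]
    congr 1
    calc _ = (Real.Gamma (α - β))⁻¹ * (Real.Gamma (β - γ))⁻¹ *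
          (u * (1 - u) / D ^ 2 * (((1 - u) * w / D) ^ (α - β - 1) * (u / D) ^ (-α - 1)) *
      (D / u * (((1 - u) * (1 - w)) ^ (β - γ - 1) * D ^ (-β - 1)))) := by ring
      _ = _ := by
        rw [e]
        generalize (1 - u) ^ (α - γ - 1) = x1
        generalize u ^ (-α - 1) = x2
        generalize w ^ (α - β - 1) = x3
        generalize (1 - w) ^ (β - γ - 1) = x4
        field_simp
  · intro w hw
    have hD := hDpos w hw
    have h : HasDerivAt (fun w : ℝ => u + (1 - u) * w) (1 - u) w := by
      simpa using ((hasDerivAt_id w).const_mul (1 - u)).const_add u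
    have h2 := (hasDerivAt_const w u).div h hD.ne'
    refine (h2.congr_deriv ?_).hasDerivWithinAt
    ring
  · intro w hw w' hw' h
    have hD := hDpos w hw
    have hD' := hDpos w' hw'
    simp only at h
    rw [div_eq_div_iff hD.ne' hD'.ne'] at h
    have := mul_left_cancel₀ hu.ne' h
    have := mul_left_cancel₀ hP.ne' (add_left_cancel this)
    exact this.symm

lemma scale_integral (t : ℝ) (ht : 0 < t) (g : ℝ → ENNReal) :
    ∫⁻ s in Ioo (0 : ℝ) 1, g s = ∫⁻ u in Ioo 0 t, ENNReal.ofReal t⁻¹ * g (t⁻¹ * u) := by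
  have him : (fun u : ℝ => t⁻¹ * u) '' Ioo 0 t = Ioo 0 1 := by
    rw [image_mul_left_Ioo (inv_pos.2 ht)]
    simp [ht.ne']
  rw [← him, lintegral_image_eq_lintegral_abs_deriv_mul (f' := fun _ => t⁻¹) measurableSet_Ioo]
  · rw [abs_of_pos (inv_pos.2 ht)]
  · intro x _
    simpa using ((hasDerivAt_id x).const_mul t⁻¹).hasDerivWithinAt
  · intro x _ y _ h
    exact mul_left_cancel₀ (inv_pos.2 ht).ne' h

lemma map_mul_betaType (α β γ : ℝ) (hγβ : γ < β) (hβα : β < α) :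
    Measure.map (fun p : ℝ × ℝ => p.1 * p.2)
        ((betaTypeMeasure β α).prod (betaTypeMeasure γ β)) = betaTypeMeasure γ α := by
  have hm1 := measurable_betaDens β α
  have hm2 := measurable_betaDens γ β
  refine Measure.ext_of_lintegral _ fun φ hφ => ?_
  rw [lintegral_map hφ (by fun_prop), lintegral_prod _ (by fun_prop),
    lintegral_betaTypeMeasure _ _ hφ]
  have hin : ∀ t, ∫⁻ s, φ (t * s) ∂(betaTypeMeasure γ β) =
      ∫⁻ s in Ioo (0 : ℝ) 1, betaDens γ β s * φ (t * s) := fun t =>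
    lintegral_betaTypeMeasure _ _ (by fun_prop)
  rw [lintegral_betaTypeMeasure]
  swap
  · exact Measurable.lintegral_prod_right' (f := fun p : ℝ × ℝ => φ (p.1 * p.2)) (by fun_prop)
  -- joint kernel
  let F : ℝ → ℝ → ENNReal := fun t u =>
    betaDens β α t * (ENNReal.ofReal t⁻¹ * betaDens γ β (t⁻¹ * u)) * φ u
  let T : Set (ℝ × ℝ) := {p | p.2 < p.1}
  have hT : MeasurableSet T := measurableSet_lt measurable_snd measurable_fst
  have hF : Measurable (Function.uncurry F) := by
    simp only [F, Function.uncurry_def]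
    fun_prop
  have h1 : ∀ t ∈ Ioo (0 : ℝ) 1, betaDens β α t * ∫⁻ s, φ (t * s) ∂(betaTypeMeasure γ β) =
      ∫⁻ u in Ioo (0 : ℝ) 1, T.indicator (Function.uncurry F) (t, u) := by
    intro t ht
    have : ∀ u, T.indicator (Function.uncurry F) (t, u) = (Iio t).indicator (F t) u := by
      intro u
      simp [T, indicator, Function.uncurry]
    simp only [this]
    rw [setLIntegral_indicator measurableSet_Iio, hin, scale_integral t ht.1,
      ← lintegral_const_mul _ (by fun_prop)]
    have hset : Iio t ∩ Ioo 0 1 = Ioo 0 t := by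
      ext x
      simp only [mem_inter_iff, mem_Iio, mem_Ioo]
      constructor
      · rintro ⟨a, b, c⟩; exact ⟨b, a⟩
      · rintro ⟨a, b⟩; exact ⟨b, a, b.trans ht.2⟩
    rw [hset]
    refine lintegral_congr fun u => ?_
    simp only [F]
    rw [mul_inv_cancel_left₀ ht.1.ne']
    ring
  have h2 : ∀ u ∈ Ioo (0 : ℝ) 1,
      ∫⁻ t in Ioo (0 : ℝ) 1, T.indicator (Function.uncurry F) (t, u) = betaDens γ α u * φ u := by
    intro u hu
    have : ∀ t, T.indicator (Function.uncurry F) (t, u) =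
        (Ioi u).indicator (fun t => F t u) t := by
      intro t
      simp [T, indicator, Function.uncurry]
    simp only [this]
    have hset : Ioi u ∩ Ioo 0 1 = Ioo u 1 := by
      ext x
      simp only [mem_inter_iff, mem_Ioi, mem_Ioo]
      constructor
      · rintro ⟨a, b, c⟩; exact ⟨a, c⟩
      · rintro ⟨a, b⟩; exact ⟨a, hu.1.trans a, b⟩
    rw [setLIntegral_indicator measurableSet_Ioi, hset, ← key_integral α β γ hγβ hβα u hu.1 hu.2,
      ← lintegral_mul_const _ (by fun_prop)]
  rw [setLIntegral_congr_fun measurableSet_Ioo h1,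
    lintegral_lintegral_swap (f := fun t u => T.indicator (Function.uncurry F) (t, u))
      (hF.indicator hT).aemeasurable]
  exact setLIntegral_congr_fun measurableSet_Ioo h2

theorem betaType_pushforward_mul (α β γ : ℝ) (hγβ : γ < β) (hβα : β < α) :
    Measure.map (fun p : ℝ × ℝ => p.1 * p.2)
        ((betaTypeMeasure β α).prod (betaTypeMeasure γ β)) = betaTypeMeasure γ α ∧
    Measure.map (fun p : ℝ × ℝ => p.1 * p.2)
        ((betaTypeMeasure β α).prod (betaTypeMeasure γ β))
      = Measure.map (fun p : ℝ × ℝ => p.1 * p.2)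
          ((betaTypeMeasure γ β).prod (betaTypeMeasure β α)) := by
  refine ⟨map_mul_betaType α β γ hγβ hβα, ?_⟩
  rw [← Measure.prod_swap, Measure.map_map (by fun_prop) measurable_swap]
  congr 1
  ext p
  simp [mul_comm]
end

section
/- Let k ≥ 2 be an integer and let α_1 > α_2 > ... > α_k be real numbers. Then the pushforward of the product measure ν_{α_2,α_1} ⊗ ν_{α_3,α_2} ⊗ ... ⊗ ν_{α_k,α_{k-1}} under the map (s_1, ..., s_{k-1}) ↦ s_1 · s_2 · ... · s_{k-1} equals ν_{α_k,α_1}. -/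
open MeasureTheory Real Set

/-- The density of the Beta-type measure, extended by zero. -/
noncomputable def betaTypeDens (β α : ℝ) : ℝ → ENNReal :=
  (Set.Ioo (0 : ℝ) 1).indicator
    (fun s => ENNReal.ofReal ((Real.Gamma (α - β))⁻¹ * (1 - s) ^ (α - β - 1) * s ^ (-α - 1)))

lemma betaTypeDens_measurable (β α : ℝ) : Measurable (betaTypeDens β α) := by
  unfold betaTypeDens
  exact Measurable.indicator (by fun_prop) measurableSet_Ioo

lemma betaTypeMeasure_eq (β α : ℝ) :
    betaTypeMeasure β α = volume.withDensity (betaTypeDens β α) := by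
  unfold betaTypeMeasure betaTypeDens
  rw [withDensity_indicator measurableSet_Ioo]

instance betaTypeMeasure_sigmaFinite (β α : ℝ) : SigmaFinite (betaTypeMeasure β α) := by
  unfold betaTypeMeasure
  exact SigmaFinite.withDensity_ofReal _

lemma lintegral_affine_subst (f : ℝ → ENNReal) {c : ℝ} (hc : 0 < c) (d : ℝ) :
    ∫⁻ x, f x = ∫⁻ x, ENNReal.ofReal c * f (d + c * x) := by
  have h := lintegral_image_eq_lintegral_abs_deriv_mul (s := univ) (f := fun x : ℝ => d + c * x)
    (f' := fun _ => c) MeasurableSet.univ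
    (fun x _ => by
      simpa using (((hasDerivAt_id x).const_mul c).const_add d))
    (fun x _ y _ hxy => by simpa [hc.ne'] using hxy) f
  have hs : (fun x : ℝ => d + c * x) '' univ = univ := by
    rw [image_univ]
    refine Function.Surjective.range_eq fun y => ⟨(y - d) / c, ?_⟩
    field_simp
    ring
  rw [hs] at h
  simpa [abs_of_pos hc] using h

lemma real_kernel_identity {a b c u t : ℝ} (hab : b < a) (hbc : c < b) (hu0 : 0 < u) (hu1 : u < 1)
    (ht0 : 0 < t) (ht1 : t < 1) :
    (1 - u) * (((Real.Gamma (b - c))⁻¹ * (1 - (u + (1 - u) * t)) ^ (b - c - 1)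
        * (u + (1 - u) * t) ^ (-b - 1)) * (u + (1 - u) * t)⁻¹ *
      ((Real.Gamma (a - b))⁻¹ * (1 - (u + (1 - u) * t)⁻¹ * u) ^ (a - b - 1)
        * ((u + (1 - u) * t)⁻¹ * u) ^ (-a - 1)))
    = ((Real.Gamma (a - c))⁻¹ * (1 - u) ^ (a - c - 1) * u ^ (-a - 1)) *
      (1 / ProbabilityTheory.beta (a - b) (b - c) * t ^ (a - b - 1) * (1 - t) ^ (b - c - 1)) := by
  have h1u : 0 < 1 - u := by linarith
  have h1t : 0 < 1 - t := by linarith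
  have hy : 0 < u + (1 - u) * t := by positivity
  have e1 : 1 - (u + (1 - u) * t) = (1 - u) * (1 - t) := by ring
  have e2 : 1 - (u + (1 - u) * t)⁻¹ * u = (1 - u) * t * (u + (1 - u) * t)⁻¹ := by
    field_simp
    ring
  rw [e1, e2]
  generalize u + (1 - u) * t = y at hy
  have g1 := Real.Gamma_pos_of_pos (sub_pos.2 hab)
  have g2 := Real.Gamma_pos_of_pos (sub_pos.2 hbc)
  have g3 := Real.Gamma_pos_of_pos (sub_pos.2 (hbc.trans hab))
  have hy' : 0 < y⁻¹ := by positivity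
  rw [ProbabilityTheory.beta, show a - b + (b - c) = a - c by ring,
    Real.mul_rpow h1u.le h1t.le, Real.mul_rpow (mul_pos h1u ht0).le hy'.le,
    Real.mul_rpow h1u.le ht0.le, Real.mul_rpow hy'.le hu0.le,
    Real.inv_rpow hy.le, Real.inv_rpow hy.le, ← Real.rpow_neg hy.le, ← Real.rpow_neg hy.le]
  have k1 : y ^ (-b - 1) * y⁻¹ * y ^ (-(a - b - 1)) * y ^ (-(-a - 1)) = 1 := by
    rw [← Real.rpow_neg_one y, ← Real.rpow_add hy, ← Real.rpow_add hy, ← Real.rpow_add hy]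
    rw [show -b - 1 + -1 + -(a - b - 1) + -(-a - 1) = 0 by ring, Real.rpow_zero]
  have k2 : (1 - u) * (1 - u) ^ (b - c - 1) * (1 - u) ^ (a - b - 1) = (1 - u) ^ (a - c - 1) := by
    nth_rewrite 1 [← Real.rpow_one (1 - u)]
    rw [← Real.rpow_add h1u, ← Real.rpow_add h1u]
    congr 1
    ring
  rw [← k2]
  calc _ = (y ^ (-b - 1) * y⁻¹ * y ^ (-(a - b - 1)) * y ^ (-(-a - 1))) *
        ((Real.Gamma (b - c))⁻¹ * (Real.Gamma (a - b))⁻¹ *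
        ((1 - u) * (1 - u) ^ (b - c - 1) * (1 - u) ^ (a - b - 1)) * (1 - t) ^ (b - c - 1) *
          t ^ (a - b - 1) * u ^ (-a - 1)) := by ring
    _ = _ := by
      rw [k1]
      field_simp

lemma kernel_lintegral {a b c : ℝ} (hab : b < a) (hbc : c < b) (u : ℝ) :
    ∫⁻ y, betaTypeDens c b y * ENNReal.ofReal y⁻¹ * betaTypeDens b a (y⁻¹ * u)
      = betaTypeDens c a u := by
  by_cases hu : u ∈ Ioo (0 : ℝ) 1
  · obtain ⟨hu0, hu1⟩ := hu
    have h1u : 0 < 1 - u := by linarith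
    rw [lintegral_affine_subst _ h1u u]
    have key : ∀ t : ℝ, ENNReal.ofReal (1 - u) * (betaTypeDens c b (u + (1 - u) * t) *
        ENNReal.ofReal (u + (1 - u) * t)⁻¹ * betaTypeDens b a ((u + (1 - u) * t)⁻¹ * u))
        = betaTypeDens c a u * ProbabilityTheory.betaPDF (a - b) (b - c) t := by
      intro t
      by_cases ht : t ∈ Ioo (0 : ℝ) 1
      · obtain ⟨ht0, ht1⟩ := ht
        have h1t : 0 < 1 - t := by linarith
        have hy : 0 < u + (1 - u) * t := by positivity
        have hy1 : u + (1 - u) * t < 1 := by nlinarith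
        have hyu : (u + (1 - u) * t)⁻¹ * u < 1 := by
          rw [inv_mul_lt_one₀ hy]
          nlinarith
        have g2 := Real.Gamma_pos_of_pos (sub_pos.2 hbc)
        have g3 := Real.Gamma_pos_of_pos (sub_pos.2 (hbc.trans hab))
        have hq : 0 < 1 - (u + (1 - u) * t) := by linarith
        unfold betaTypeDens
        rw [indicator_of_mem (show _ ∈ Ioo (0 : ℝ) 1 from ⟨hy, hy1⟩),
          indicator_of_mem (show _ ∈ Ioo (0 : ℝ) 1 from ⟨by positivity, hyu⟩),
          indicator_of_mem (show _ ∈ Ioo (0 : ℝ) 1 from ⟨hu0, hu1⟩),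
          ProbabilityTheory.betaPDF_of_pos_lt_one ht0 ht1,
          ← ENNReal.ofReal_mul (by positivity), ← ENNReal.ofReal_mul (by positivity),
          ← ENNReal.ofReal_mul (by positivity), ← ENNReal.ofReal_mul (by positivity),
          real_kernel_identity hab hbc hu0 hu1 ht0 ht1]
      · have hr : ProbabilityTheory.betaPDF (a - b) (b - c) t = 0 := by
          rcases le_or_gt t 0 with h | h
          · exact ProbabilityTheory.betaPDF_eq_zero_of_nonpos h
          · exact ProbabilityTheory.betaPDF_eq_zero_of_one_le
              (not_lt.1 fun h' => ht ⟨h, h'⟩)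
        rw [hr, mul_zero]
        by_cases hy : u + (1 - u) * t ∈ Ioo (0 : ℝ) 1
        · have : (u + (1 - u) * t)⁻¹ * u ∉ Ioo (0 : ℝ) 1 := by
            rintro ⟨-, h⟩
            rw [inv_mul_lt_one₀ hy.1] at h
            have := hy.2
            exact ht ⟨by by_contra hh; nlinarith, by by_contra hh; nlinarith⟩
          simp [betaTypeDens, indicator_of_notMem this]
        · simp [betaTypeDens, indicator_of_notMem hy]
    simp_rw [key]
    rw [lintegral_const_mul' _ _ (by
      simp [betaTypeDens, indicator_of_mem (show u ∈ Ioo (0 : ℝ) 1 from ⟨hu0, hu1⟩)]),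
      ProbabilityTheory.lintegral_betaPDF_eq_one (sub_pos.2 hab) (sub_pos.2 hbc), mul_one]
  · have h0 : betaTypeDens c a u = 0 := indicator_of_notMem hu _
    rw [h0]
    refine (lintegral_congr fun y => ?_).trans lintegral_zero
    by_cases hy : y ∈ Ioo (0 : ℝ) 1
    · have : y⁻¹ * u ∉ Ioo (0 : ℝ) 1 := by
        rintro ⟨h1, h2⟩
        rw [inv_mul_lt_one₀ hy.1] at h2
        have := hy.2
        exact hu ⟨pos_of_mul_pos_right h1 (inv_pos.2 hy.1).le, by linarith⟩
      simp [betaTypeDens, indicator_of_notMem this]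
    · simp [betaTypeDens, indicator_of_notMem hy]

lemma betaType_mul_pair {a b c : ℝ} (hab : b < a) (hbc : c < b) :
    Measure.map (fun p : ℝ × ℝ => p.1 * p.2) ((betaTypeMeasure b a).prod (betaTypeMeasure c b))
      = betaTypeMeasure c a := by
  have m1 := betaTypeDens_measurable b a
  have m2 := betaTypeDens_measurable c b
  ext A hA
  have mA : Measurable (A.indicator (fun _ => (1 : ENNReal))) := measurable_const.indicator hA
  have hmul : Measurable (fun p : ℝ × ℝ => p.1 * p.2) := by fun_prop
  rw [← lintegral_indicator_one hA, ← lintegral_indicator_one hA]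
  change ∫⁻ x, A.indicator (fun _ => (1 : ENNReal)) x ∂_ =
    ∫⁻ x, A.indicator (fun _ => (1 : ENNReal)) x ∂_
  set χ := A.indicator (fun _ => (1 : ENNReal)) with hχ
  rw [lintegral_map mA hmul, lintegral_prod_symm' (fun p : ℝ × ℝ => χ (p.1 * p.2)) (mA.comp hmul),
    betaTypeMeasure_eq c b, lintegral_withDensity_eq_lintegral_mul _ m2 (by
      exact (Measurable.lintegral_prod_left' (mA.comp hmul))),
    betaTypeMeasure_eq c a, lintegral_withDensity_eq_lintegral_mul _
      (betaTypeDens_measurable c a) mA]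
  have step : ∀ y : ℝ, (betaTypeDens c b * fun y => ∫⁻ x, χ (x * y) ∂betaTypeMeasure b a) y
      = ∫⁻ u, betaTypeDens c b y * ENNReal.ofReal y⁻¹ * betaTypeDens b a (y⁻¹ * u) * χ u := by
    intro y
    by_cases hy : y ∈ Ioo (0 : ℝ) 1
    · have hy0 := hy.1
      have hfin : betaTypeDens c b y ≠ ⊤ := by simp [betaTypeDens, indicator_of_mem hy]
      rw [Pi.mul_apply, betaTypeMeasure_eq b a, lintegral_withDensity_eq_lintegral_mul _ m1
        (by fun_prop), lintegral_affine_subst _ (inv_pos.2 hy0) 0,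
        ← lintegral_const_mul' _ _ hfin]
      refine lintegral_congr fun u => ?_
      have : (0 + y⁻¹ * u) * y = u := by field_simp; ring
      simp only [Pi.mul_apply, this, zero_add]
      have : (y⁻¹ * u) * y = u := by field_simp
      simp only [this]
      ring
    · simp [betaTypeDens, indicator_of_notMem hy]
  calc _ = ∫⁻ y, ∫⁻ u, betaTypeDens c b y * ENNReal.ofReal y⁻¹ *
        betaTypeDens b a (y⁻¹ * u) * χ u := lintegral_congr step
    _ = ∫⁻ u, ∫⁻ y, betaTypeDens c b y * ENNReal.ofReal y⁻¹ *
        betaTypeDens b a (y⁻¹ * u) * χ u := lintegral_lintegral_swap (by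
          apply Measurable.aemeasurable
          unfold Function.uncurry
          fun_prop)
    _ = _ := by
      refine lintegral_congr fun u => ?_
      rw [lintegral_mul_const _ (by fun_prop), kernel_lintegral hab hbc, Pi.mul_apply]

/-- Corollary 2: with `k = n + 1 ≥ 2` reals `α 0 > α 1 > ... > α n`, the pushforward of
`ν_{α 1, α 0} ⊗ ν_{α 2, α 1} ⊗ ... ⊗ ν_{α n, α (n-1)}` under multiplication of all
coordinates is `ν_{α n, α 0}`. -/
theorem betaType_pushforward_prod_chain (n : ℕ) (hn : 1 ≤ n) (α : Fin (n + 1) → ℝ)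
    (hα : StrictAnti α) :
    Measure.map (fun s : Fin n → ℝ => ∏ i, s i)
        (Measure.pi fun i : Fin n => betaTypeMeasure (α i.succ) (α i.castSucc))
      = betaTypeMeasure (α (Fin.last n)) (α 0) := by
  induction n, hn using Nat.le_induction with
  | base =>
    have h := (measurePreserving_piUnique
      (fun i : Fin 1 => betaTypeMeasure (α i.succ) (α i.castSucc))).map_eq
    have hfun : (fun s : Fin 1 → ℝ => ∏ i, s i) = MeasurableEquiv.piUnique (fun _ => ℝ) := by
      funext s
      simp
    rw [hfun, h]
    rfl
  | succ n hn ih =>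
    have ih' := ih (fun i => α i.succ) (fun i j hij => hα (Fin.succ_lt_succ_iff.2 hij))
    have hmp := measurePreserving_piFinSuccAbove
      (fun i : Fin (n + 1) => betaTypeMeasure (α i.succ) (α i.castSucc)) 0
    have hprod : Measurable (fun s : Fin n → ℝ => ∏ i, s i) := by fun_prop
    have hfun : (fun s : Fin (n + 1) → ℝ => ∏ i, s i) =
        (fun p : ℝ × ℝ => p.1 * p.2) ∘ (Prod.map id (fun s : Fin n → ℝ => ∏ i, s i)) ∘
          (MeasurableEquiv.piFinSuccAbove (fun _ => ℝ) 0) := by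
      funext s
      simp [Fin.prod_univ_succ, Fin.tail, Fin.removeNth]
    rw [hfun, ← Measure.map_map (by fun_prop) (by fun_prop),
      ← Measure.map_map (by fun_prop) (by fun_prop), hmp.map_eq]
    have : SFinite (Measure.map (fun s : Fin n → ℝ => ∏ i, s i) (Measure.pi fun j : Fin n =>
      betaTypeMeasure (α (Fin.succAbove 0 j).succ) (α (Fin.succAbove 0 j).castSucc))) := inferInstance
    rw [← Measure.map_prod_map _ _ measurable_id hprod, Measure.map_id]
    have e : Measure.map (fun s : Fin n → ℝ => ∏ i, s i) (Measure.pi fun j : Fin n =>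
      betaTypeMeasure (α (Fin.succAbove 0 j).succ) (α (Fin.succAbove 0 j).castSucc)) =
        betaTypeMeasure (α (Fin.last (n + 1))) (α 1) := by
      simpa using ih'
    rw [e]
    have h1 : α 1 < α 0 := hα (by simp)
    have h2 : α (Fin.last (n + 1)) < α 1 := hα (by
      rw [Fin.lt_def]; simp; omega)
    simpa using betaType_mul_pair h1 h2
end
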